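/- Along any B₀ T²-symmetric Einstein flow, at every time τ one has |Λ| − (e^{−2τ}/2)|A| ≲ e^{−τ} (1 + e^{2(ΠE)^{1/2}}) Π E. -/

import Mathlib

noncomputable section

open Real MeasureTheory intervalIntegral

/-- The θ-mean of a function on the circle of circumference 1 (total measure 1). -/
def circleMean (f : ℝ → ℝ) : ℝ := ∫ θ in (0:ℝ)..1, f θ

/-- The smooth, θ-periodic fields `V, Q, ρ, l` of a T²-symmetric spacetime in areal
coordinates; first argument is `τ`, second is `θ`. -/
structure T2Flow where
  V : ℝ → ℝ → ℝ
  Q : ℝ → ℝ → ℝ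
  ρ : ℝ → ℝ → ℝ
  l : ℝ → ℝ → ℝ
  smooth_V : ContDiff ℝ (⊤ : ℕ∞) (Function.uncurry V)
  smooth_Q : ContDiff ℝ (⊤ : ℕ∞) (Function.uncurry Q)
  smooth_ρ : ContDiff ℝ (⊤ : ℕ∞) (Function.uncurry ρ)
  smooth_l : ContDiff ℝ (⊤ : ℕ∞) (Function.uncurry l)
  periodic_V : ∀ τ, Function.Periodic (V τ) 1
  periodic_Q : ∀ τ, Function.Periodic (Q τ) 1
  periodic_ρ : ∀ τ, Function.Periodic (ρ τ) 1
  periodic_l : ∀ τ, Function.Periodic (l τ) 1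

namespace T2Flow

/-- `V_τ`. -/
def Vτ (F : T2Flow) (τ θ : ℝ) : ℝ := deriv (fun s => F.V s θ) τ
/-- `V_θ`. -/
def Vθ (F : T2Flow) (τ θ : ℝ) : ℝ := deriv (fun x => F.V τ x) θ
/-- `Q_τ`. -/
def Qτ (F : T2Flow) (τ θ : ℝ) : ℝ := deriv (fun s => F.Q s θ) τ
/-- `Q_θ`. -/
def Qθ (F : T2Flow) (τ θ : ℝ) : ℝ := deriv (fun x => F.Q τ x) θ
/-- `ρ_τ`. -/
def ρτ (F : T2Flow) (τ θ : ℝ) : ℝ := deriv (fun s => F.ρ s θ) τ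
/-- `l_τ`. -/
def lτ (F : T2Flow) (τ θ : ℝ) : ℝ := deriv (fun s => F.l s θ) τ
/-- `l_θ`. -/
def lθ (F : T2Flow) (τ θ : ℝ) : ℝ := deriv (fun x => F.l τ x) θ

/-- The energy density
`J = (1/2)[V_τ² + e^{2(τ−ρ)}V_θ² + e^{2(V−τ)}(Q_τ² + e^{2(τ−ρ)}Q_θ²)]`. -/
def J (F : T2Flow) (τ θ : ℝ) : ℝ :=
  (1/2) * (F.Vτ τ θ ^ 2 + exp (2*(τ - F.ρ τ θ)) * F.Vθ τ θ ^ 2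
    + exp (2*(F.V τ θ - τ)) * (F.Qτ τ θ ^ 2 + exp (2*(τ - F.ρ τ θ)) * F.Qθ τ θ ^ 2))

/-- The T²-symmetric vacuum Einstein evolution equations together with the
momentum constraint. -/
def IsEinsteinFlow (F : T2Flow) : Prop :=
  (∀ τ θ : ℝ, deriv (fun s => exp (F.ρ s θ) * F.Vτ s θ) τ
      = deriv (fun x => exp (2*τ - F.ρ τ x) * F.Vθ τ x) θ
        + exp (2*(F.V τ θ - τ) + F.ρ τ θ)
          * (F.Qτ τ θ ^ 2 - exp (2*(τ - F.ρ τ θ)) * F.Qθ τ θ ^ 2)) ∧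
  (∀ τ θ : ℝ, deriv (fun s => exp (F.ρ s θ + 2*(F.V s θ - s)) * F.Qτ s θ) τ
      = deriv (fun x => exp (-F.ρ τ x + 2*F.V τ x) * F.Qθ τ x) θ) ∧
  (∀ τ θ : ℝ, F.lτ τ θ + F.ρτ τ θ + 2 = F.J τ θ) ∧
  (∀ τ θ : ℝ, F.ρτ τ θ = exp (F.l τ θ)) ∧
  (∀ τ θ : ℝ, F.lθ τ θ = F.Vθ τ θ * F.Vτ τ θ
      + exp (2*(F.V τ θ - τ)) * F.Qθ τ θ * F.Qτ τ θ)

/-- The conserved quantity `A = ∫ e^ρ (V_τ − e^{2(V−τ)} Q_τ Q) dθ`. -/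
def A (F : T2Flow) (τ : ℝ) : ℝ :=
  ∫ θ in (0:ℝ)..1,
    exp (F.ρ τ θ) * (F.Vτ τ θ - exp (2*(F.V τ θ - τ)) * F.Qτ τ θ * F.Q τ θ)

/-- The conserved quantity `B = ∫ e^{ρ+2(V−τ)} Q_τ dθ`. -/
def B (F : T2Flow) (τ : ℝ) : ℝ :=
  ∫ θ in (0:ℝ)..1, exp (F.ρ τ θ + 2*(F.V τ θ - τ)) * F.Qτ τ θ

/-- The energy `E = ∫ e^{ρ−2τ} J dθ`. -/
def E (F : T2Flow) (τ : ℝ) : ℝ := ∫ θ in (0:ℝ)..1, exp (F.ρ τ θ - 2*τ) * F.J τ θ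

/-- The `S¹`-volume `Π = ⟨e^ρ⟩`. -/
def Pi (F : T2Flow) (τ : ℝ) : ℝ := ∫ θ in (0:ℝ)..1, exp (F.ρ τ θ)

/-- The correction `Λ = (1/2) e^{−2τ} ∫ V_τ (V − ⟨V⟩ − 1) e^ρ dθ`. -/
def Λ (F : T2Flow) (τ : ℝ) : ℝ :=
  (1/2) * exp (-2*τ) *
    ∫ θ in (0:ℝ)..1, F.Vτ τ θ * (F.V τ θ - circleMean (F.V τ) - 1) * exp (F.ρ τ θ)

/-- The corrected, normalized energy `H = Π (E + Λ)`. -/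
def H (F : T2Flow) (τ : ℝ) : ℝ := F.Pi τ * (F.E τ + F.Λ τ)

/-- The twist potential `Y = ⟨e^{l+ρ+2τ}⟩`. -/
def Y (F : T2Flow) (τ : ℝ) : ℝ := ∫ θ in (0:ℝ)..1, exp (F.l τ θ + F.ρ τ θ + 2*τ)

/-- The error term `Ω = ⟨e^{l+ρ+2τ} J⟩ − e^{2τ} E Y Π⁻¹`. -/
def Ω (F : T2Flow) (τ : ℝ) : ℝ :=
  (∫ θ in (0:ℝ)..1, exp (F.l τ θ + F.ρ τ θ + 2*τ) * F.J τ θ)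
    - exp (2*τ) * F.E τ * F.Y τ / F.Pi τ

end T2Flow

/-- Weighted Cauchy–Schwarz inequality on `[0, 1]` with weight `e^r`. -/
theorem sq_integral_exp_mul_abs_le {r g : ℝ → ℝ} (hr : Continuous r) (hg : Continuous g) :
    (∫ θ in (0:ℝ)..1, exp (r θ) * |g θ|) ^ 2
      ≤ (∫ θ in (0:ℝ)..1, exp (r θ)) * ∫ θ in (0:ℝ)..1, exp (r θ) * g θ ^ 2 := by
  have key : ∀ t : ℝ, 0 ≤ (∫ θ in (0:ℝ)..1, exp (r θ)) * (t * t)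
      + (2 * ∫ θ in (0:ℝ)..1, exp (r θ) * |g θ|) * t
      + ∫ θ in (0:ℝ)..1, exp (r θ) * g θ ^ 2 := by
    intro t
    have h : 0 ≤ ∫ θ in (0:ℝ)..1, exp (r θ) * (t + |g θ|) ^ 2 :=
      integral_nonneg zero_le_one fun θ _ => by positivity
    have e : (fun θ => exp (r θ) * (t + |g θ|) ^ 2) = fun θ =>
        (t * t) * exp (r θ) + (2 * t) * (exp (r θ) * |g θ|) + exp (r θ) * g θ ^ 2 := by
      funext θ
      rw [← sq_abs (g θ)]
      ring
    rw [e, intervalIntegral.integral_add, intervalIntegral.integral_add,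
      intervalIntegral.integral_const_mul, intervalIntegral.integral_const_mul] at h
    · linarith
    all_goals exact Continuous.intervalIntegrable (by fun_prop) _ _
  have := discrim_le_zero key
  unfold discrim at this
  linarith

/-- The increment of a `C¹` function over points of `[0, 1]` is at most the total variation. -/
theorem abs_sub_le_integral_abs_deriv {f : ℝ → ℝ} (hf : ContDiff ℝ 1 f) {x y : ℝ}
    (hx : x ∈ Set.Icc (0:ℝ) 1) (hy : y ∈ Set.Icc (0:ℝ) 1) :
    |f y - f x| ≤ ∫ θ in (0:ℝ)..1, |deriv f θ| := by
  have hc : Continuous (deriv f) := hf.continuous_deriv le_rfl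
  wlog hxy : x ≤ y generalizing x y
  · rw [abs_sub_comm]
    exact this hy hx (le_of_not_ge hxy)
  rw [← integral_deriv_eq_sub (fun z _ => (hf.differentiable (by norm_num)) z)
    (hc.intervalIntegrable _ _)]
  calc |∫ θ in x..y, deriv f θ| ≤ ∫ θ in x..y, |deriv f θ| := abs_integral_le_integral_abs hxy
    _ ≤ ∫ θ in (0:ℝ)..1, |deriv f θ| :=
      integral_mono_interval hx.1 hxy hy.2 (Filter.Eventually.of_forall fun _ => abs_nonneg _)
        (hc.abs.intervalIntegrable _ _)

/-- `L¹`–`L∞` Hölder inequality on `[0, 1]` for continuous functions. -/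
theorem abs_integral_mul_le_mul {f g : ℝ → ℝ} (hf : Continuous f) (hg : Continuous g) {c : ℝ}
    (h : ∀ θ ∈ Set.Icc (0:ℝ) 1, |g θ| ≤ c) :
    |∫ θ in (0:ℝ)..1, f θ * g θ| ≤ (∫ θ in (0:ℝ)..1, |f θ|) * c := by
  rw [← intervalIntegral.integral_mul_const]
  refine (abs_integral_le_integral_abs zero_le_one).trans
    (integral_mono_on zero_le_one (Continuous.intervalIntegrable (by fun_prop) _ _)
      (Continuous.intervalIntegrable (by fun_prop) _ _) fun θ hθ => ?_)
  rw [abs_mul]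
  exact mul_le_mul_of_nonneg_left (h θ hθ) (abs_nonneg _)

/-- The `τ`-derivative of a smooth function of `(τ, θ)` is continuous in `θ`. -/
theorem continuous_deriv_left {f : ℝ → ℝ → ℝ}
    (hf : ContDiff ℝ (⊤ : ℕ∞) (Function.uncurry f)) (τ : ℝ) :
    Continuous fun θ => deriv (fun s => f s θ) τ := by
  have h : (fun θ => deriv (fun s => f s θ) τ)
      = fun θ => fderiv ℝ (Function.uncurry f) (τ, θ) (1, 0) := by
    funext θ
    have h1 : HasFDerivAt (Function.uncurry f) (fderiv ℝ (Function.uncurry f) (τ, θ)) (τ, θ) :=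
      ((hf.differentiable (by simp)) (τ, θ)).hasFDerivAt
    have h2 : HasDerivAt (fun s : ℝ => (s, θ)) (1, 0) τ :=
      (hasDerivAt_id τ).prodMk (hasDerivAt_const τ θ)
    exact (h1.comp_hasDerivAt τ h2).deriv
  rw [h]
  have hc : Continuous fun θ : ℝ => (τ, θ) := by fun_prop
  exact ((hf.continuous_fderiv (by simp)).comp hc).clm_apply continuous_const

/-- A slice of a smooth function of `(τ, θ)` at constant `τ` is `C¹`. -/
theorem contDiff_slice {f : ℝ → ℝ → ℝ}
    (hf : ContDiff ℝ (⊤ : ℕ∞) (Function.uncurry f)) (τ : ℝ) : ContDiff ℝ 1 (f τ) :=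
  (hf.of_le (by exact_mod_cast le_top)).comp (contDiff_const.prodMk contDiff_id)

namespace T2Flow

theorem continuous_Vτ (F : T2Flow) (τ : ℝ) : Continuous (F.Vτ τ) :=
  continuous_deriv_left F.smooth_V τ

theorem continuous_Qτ (F : T2Flow) (τ : ℝ) : Continuous (F.Qτ τ) :=
  continuous_deriv_left F.smooth_Q τ

theorem continuous_Vθ (F : T2Flow) (τ : ℝ) : Continuous (F.Vθ τ) :=
  (contDiff_slice F.smooth_V τ).continuous_deriv le_rfl

theorem continuous_Qθ (F : T2Flow) (τ : ℝ) : Continuous (F.Qθ τ) :=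
  (contDiff_slice F.smooth_Q τ).continuous_deriv le_rfl

theorem continuous_V (F : T2Flow) (τ : ℝ) : Continuous (F.V τ) :=
  (contDiff_slice F.smooth_V τ).continuous

theorem continuous_Q (F : T2Flow) (τ : ℝ) : Continuous (F.Q τ) :=
  (contDiff_slice F.smooth_Q τ).continuous

theorem continuous_ρ (F : T2Flow) (τ : ℝ) : Continuous (F.ρ τ) :=
  (contDiff_slice F.smooth_ρ τ).continuous

theorem continuous_J (F : T2Flow) (τ : ℝ) : Continuous (F.J τ) := by
  have := F.continuous_Vτ τ
  have := F.continuous_Vθ τ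
  have := F.continuous_Qτ τ
  have := F.continuous_Qθ τ
  have := F.continuous_V τ
  have := F.continuous_ρ τ
  unfold J
  fun_prop

theorem Pi_nonneg (F : T2Flow) (τ : ℝ) : 0 ≤ F.Pi τ :=
  integral_nonneg zero_le_one fun _ _ => (exp_pos _).le

theorem E_nonneg (F : T2Flow) (τ : ℝ) : 0 ≤ F.E τ :=
  integral_nonneg zero_le_one fun _ _ => by unfold J; positivity

/-- Any quantity whose square is bounded by twice the energy density is controlled in weighted
`L¹` by `(2ΠE)^{1/2}`. -/
theorem integral_exp_mul_abs_le (F : T2Flow) (τ : ℝ) {g : ℝ → ℝ} (hg : Continuous g)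
    (h : ∀ θ, g θ ^ 2 ≤ 2 * F.J τ θ) :
    ∫ θ in (0:ℝ)..1, exp (F.ρ τ θ) * |g θ| ≤ exp τ * √(2 * (F.Pi τ * F.E τ)) := by
  have hρ := F.continuous_ρ τ
  have hJ := F.continuous_J τ
  have hE : ∫ θ in (0:ℝ)..1, exp (F.ρ τ θ) * g θ ^ 2 ≤ 2 * exp τ ^ 2 * F.E τ := by
    unfold E
    rw [← intervalIntegral.integral_const_mul]
    refine integral_mono_on zero_le_one (Continuous.intervalIntegrable (by fun_prop) _ _)
      (Continuous.intervalIntegrable (by fun_prop) _ _) fun θ _ => ?_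
    have e : exp τ ^ 2 * exp (F.ρ τ θ - 2 * τ) = exp (F.ρ τ θ) := by
      rw [← exp_nat_mul, ← exp_add]
      congr 1
      push_cast
      ring
    calc exp (F.ρ τ θ) * g θ ^ 2 ≤ exp (F.ρ τ θ) * (2 * F.J τ θ) := by gcongr; exact h θ
      _ = _ := by rw [← e]; ring
  refine abs_le_of_sq_le_sq' ?_ (by positivity) |>.2
  calc _ ≤ F.Pi τ * ∫ θ in (0:ℝ)..1, exp (F.ρ τ θ) * g θ ^ 2 := sq_integral_exp_mul_abs_le hρ hg
    _ ≤ F.Pi τ * (2 * exp τ ^ 2 * F.E τ) := mul_le_mul_of_nonneg_left hE (F.Pi_nonneg τ)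
    _ = _ := by
      rw [mul_pow, sq_sqrt (by have := F.Pi_nonneg τ; have := F.E_nonneg τ; positivity)]
      ring

theorem exp_sub_mul_sq (a b x : ℝ) : (exp (a - b) * x) ^ 2 = exp (2 * (a - b)) * x ^ 2 := by
  rw [mul_pow, ← exp_nat_mul]
  norm_cast

theorem integral_exp_mul_abs_Vτ_le (F : T2Flow) (τ : ℝ) :
    ∫ θ in (0:ℝ)..1, exp (F.ρ τ θ) * |F.Vτ τ θ| ≤ exp τ * √(2 * (F.Pi τ * F.E τ)) :=
  F.integral_exp_mul_abs_le τ (F.continuous_Vτ τ) fun θ => by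
    have h : 0 ≤ exp (2*(τ - F.ρ τ θ)) * F.Vθ τ θ ^ 2
      + exp (2*(F.V τ θ - τ)) * (F.Qτ τ θ ^ 2 + exp (2*(τ - F.ρ τ θ)) * F.Qθ τ θ ^ 2) := by
      positivity
    unfold J
    linarith

theorem integral_exp_mul_abs_Qτ_le (F : T2Flow) (τ : ℝ) :
    ∫ θ in (0:ℝ)..1, exp (F.ρ τ θ) * |exp (F.V τ θ - τ) * F.Qτ τ θ|
      ≤ exp τ * √(2 * (F.Pi τ * F.E τ)) := by
  have := F.continuous_V τ
  have := F.continuous_Qτ τ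
  refine F.integral_exp_mul_abs_le τ (by fun_prop) fun θ => ?_
  have h : 0 ≤ F.Vτ τ θ ^ 2 + exp (2*(τ - F.ρ τ θ)) * F.Vθ τ θ ^ 2
      + exp (2*(F.V τ θ - τ)) * (exp (2*(τ - F.ρ τ θ)) * F.Qθ τ θ ^ 2) := by
    positivity
  rw [exp_sub_mul_sq]
  unfold J
  linarith

theorem integral_abs_Vθ_le (F : T2Flow) (τ : ℝ) :
    ∫ θ in (0:ℝ)..1, |F.Vθ τ θ| ≤ √(2 * (F.Pi τ * F.E τ)) := by
  have := F.continuous_ρ τ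
  have := F.continuous_Vθ τ
  have key := F.integral_exp_mul_abs_le τ (g := fun θ => exp (τ - F.ρ τ θ) * F.Vθ τ θ)
    (by fun_prop) fun θ => by
      have h : 0 ≤ F.Vτ τ θ ^ 2
          + exp (2*(F.V τ θ - τ)) * (F.Qτ τ θ ^ 2 + exp (2*(τ - F.ρ τ θ)) * F.Qθ τ θ ^ 2) := by
        positivity
      rw [exp_sub_mul_sq]
      unfold J
      linarith
  have e : (fun θ => exp (F.ρ τ θ) * |exp (τ - F.ρ τ θ) * F.Vθ τ θ|)
      = fun θ => exp τ * |F.Vθ τ θ| := by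
    funext θ
    rw [abs_mul, abs_exp, ← mul_assoc, ← exp_add, add_sub_cancel]
  rw [e, intervalIntegral.integral_const_mul] at key
  exact le_of_mul_le_mul_left key (exp_pos τ)

theorem integral_exp_mul_abs_Qθ_le (F : T2Flow) (τ : ℝ) :
    ∫ θ in (0:ℝ)..1, exp (F.V τ θ - τ) * |F.Qθ τ θ| ≤ √(2 * (F.Pi τ * F.E τ)) := by
  have := F.continuous_ρ τ
  have := F.continuous_V τ
  have := F.continuous_Qθ τ
  have key := F.integral_exp_mul_abs_le τ
    (g := fun θ => exp (τ - F.ρ τ θ) * (exp (F.V τ θ - τ) * F.Qθ τ θ))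
    (by fun_prop) fun θ => by
      have h : 0 ≤ F.Vτ τ θ ^ 2 + exp (2*(τ - F.ρ τ θ)) * F.Vθ τ θ ^ 2
          + exp (2*(F.V τ θ - τ)) * F.Qτ τ θ ^ 2 := by
        positivity
      rw [exp_sub_mul_sq, exp_sub_mul_sq]
      unfold J
      linarith
  have e : (fun θ => exp (F.ρ τ θ) * |exp (τ - F.ρ τ θ) * (exp (F.V τ θ - τ) * F.Qθ τ θ)|)
      = fun θ => exp τ * (exp (F.V τ θ - τ) * |F.Qθ τ θ|) := by
    funext θ
    rw [abs_mul, abs_mul, abs_exp, abs_exp, ← mul_assoc, ← exp_add, add_sub_cancel]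
  rw [e, intervalIntegral.integral_const_mul] at key
  exact le_of_mul_le_mul_left key (exp_pos τ)

theorem abs_V_sub_V_le (F : T2Flow) (τ : ℝ) {x y : ℝ} (hx : x ∈ Set.Icc (0:ℝ) 1)
    (hy : y ∈ Set.Icc (0:ℝ) 1) : |F.V τ y - F.V τ x| ≤ √(2 * (F.Pi τ * F.E τ)) :=
  (abs_sub_le_integral_abs_deriv (contDiff_slice F.smooth_V τ) hx hy).trans
    (F.integral_abs_Vθ_le τ)

theorem abs_V_sub_circleMean_le (F : T2Flow) (τ : ℝ) {y : ℝ} (hy : y ∈ Set.Icc (0:ℝ) 1) :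
    |F.V τ y - circleMean (F.V τ)| ≤ √(2 * (F.Pi τ * F.E τ)) := by
  have hV := F.continuous_V τ
  have e : F.V τ y - circleMean (F.V τ) = ∫ x in (0:ℝ)..1, (F.V τ y - F.V τ x) := by
    rw [intervalIntegral.integral_sub intervalIntegrable_const (hV.intervalIntegrable _ _)]
    simp [circleMean]
  rw [e]
  have := norm_integral_le_of_norm_le_const (a := (0:ℝ)) (b := 1)
    (f := fun x => F.V τ y - F.V τ x) (C := √(2 * (F.Pi τ * F.E τ))) fun x hx => by
      rw [Set.uIoc_of_le zero_le_one] at hx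
      exact F.abs_V_sub_V_le τ (Set.Ioc_subset_Icc_self hx) hy
  simpa using this

theorem abs_exp_mul_Q_sub_le (F : T2Flow) (τ : ℝ) {y : ℝ} (hy : y ∈ Set.Icc (0:ℝ) 1) :
    |exp (F.V τ y - τ) * (F.Q τ y - F.Q τ 0)|
      ≤ exp √(2 * (F.Pi τ * F.E τ)) * √(2 * (F.Pi τ * F.E τ)) := by
  have hV := F.continuous_V τ
  have hQ := F.continuous_Qθ τ
  rw [abs_mul, abs_exp]
  calc exp (F.V τ y - τ) * |F.Q τ y - F.Q τ 0|
      ≤ exp (F.V τ y - τ) * ∫ θ in (0:ℝ)..1, |F.Qθ τ θ| := by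
        gcongr
        exact abs_sub_le_integral_abs_deriv (contDiff_slice F.smooth_Q τ) (by simp) hy
    _ = ∫ θ in (0:ℝ)..1, exp (F.V τ y - τ) * |F.Qθ τ θ| := by
        rw [intervalIntegral.integral_const_mul]
    _ ≤ ∫ θ in (0:ℝ)..1, exp √(2 * (F.Pi τ * F.E τ)) * (exp (F.V τ θ - τ) * |F.Qθ τ θ|) := by
        refine integral_mono_on zero_le_one (Continuous.intervalIntegrable (by fun_prop) _ _)
          (Continuous.intervalIntegrable (by fun_prop) _ _) fun θ hθ => ?_
        rw [← mul_assoc, ← exp_add]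
        gcongr
        linarith [(abs_le.1 (F.abs_V_sub_V_le τ hθ hy)).2]
    _ ≤ _ := by
        rw [intervalIntegral.integral_const_mul]
        gcongr
        exact F.integral_exp_mul_abs_Qθ_le τ

theorem abs_integral_Vτ_mul_V_sub_circleMean_le (F : T2Flow) (τ : ℝ) :
    |∫ θ in (0:ℝ)..1, (exp (F.ρ τ θ) * F.Vτ τ θ) * (F.V τ θ - circleMean (F.V τ))|
      ≤ exp τ * (2 * (F.Pi τ * F.E τ)) := by
  have := F.continuous_ρ τ
  have := F.continuous_V τ
  have := F.continuous_Vτ τ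
  have h := abs_integral_mul_le_mul (f := fun θ => exp (F.ρ τ θ) * F.Vτ τ θ)
    (g := fun θ => F.V τ θ - circleMean (F.V τ)) (by fun_prop) (by fun_prop)
    fun θ hθ => F.abs_V_sub_circleMean_le τ hθ
  simp only [abs_mul, abs_exp] at h
  refine h.trans ((mul_le_mul_of_nonneg_right (F.integral_exp_mul_abs_Vτ_le τ)
    (sqrt_nonneg _)).trans_eq ?_)
  rw [mul_assoc, mul_self_sqrt (by have := F.Pi_nonneg τ; have := F.E_nonneg τ; positivity)]

/-- For `B = 0` the mean of `e^ρ V_τ` agrees with `A` up to an energy-controlled error. -/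
theorem abs_integral_exp_mul_Vτ_sub_A_le (F : T2Flow) (τ : ℝ) (hB : F.B τ = 0) :
    |(∫ θ in (0:ℝ)..1, exp (F.ρ τ θ) * F.Vτ τ θ) - F.A τ|
      ≤ exp τ * exp √(2 * (F.Pi τ * F.E τ)) * (2 * (F.Pi τ * F.E τ)) := by
  have := F.continuous_ρ τ
  have := F.continuous_V τ
  have := F.continuous_Q τ
  have := F.continuous_Vτ τ
  have := F.continuous_Qτ τ
  have e : (∫ θ in (0:ℝ)..1, exp (F.ρ τ θ) * F.Vτ τ θ) - F.A τ
      = ∫ θ in (0:ℝ)..1, (exp (F.ρ τ θ) * (exp (F.V τ θ - τ) * F.Qτ τ θ))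
          * (exp (F.V τ θ - τ) * (F.Q τ θ - F.Q τ 0)) := by
    calc _ = (∫ θ in (0:ℝ)..1, exp (F.ρ τ θ) * F.Vτ τ θ) - F.A τ - F.Q τ 0 * F.B τ := by
          rw [hB, mul_zero, sub_zero]
      _ = _ := by
          unfold A B
          rw [← intervalIntegral.integral_const_mul, ← intervalIntegral.integral_sub,
            ← intervalIntegral.integral_sub]
          · refine integral_congr fun θ _ => ?_
            have h : exp (2 * (F.V τ θ - τ)) = exp (F.V τ θ - τ) ^ 2 := by
              rw [← exp_nat_mul]
              norm_cast
            simp only [exp_add, h]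
            ring
          all_goals exact Continuous.intervalIntegrable (by fun_prop) _ _
  have h := abs_integral_mul_le_mul
    (f := fun θ => exp (F.ρ τ θ) * (exp (F.V τ θ - τ) * F.Qτ τ θ))
    (g := fun θ => exp (F.V τ θ - τ) * (F.Q τ θ - F.Q τ 0)) (by fun_prop) (by fun_prop)
    fun θ hθ => F.abs_exp_mul_Q_sub_le τ hθ
  simp only [abs_mul (exp (F.ρ τ _)), abs_exp] at h
  rw [e]
  refine h.trans ((mul_le_mul_of_nonneg_right (F.integral_exp_mul_abs_Qτ_le τ)
    (by positivity)).trans_eq ?_)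
  have hM : √(2 * (F.Pi τ * F.E τ)) * √(2 * (F.Pi τ * F.E τ)) = 2 * (F.Pi τ * F.E τ) :=
    mul_self_sqrt (by have := F.Pi_nonneg τ; have := F.E_nonneg τ; positivity)
  linear_combination exp τ * exp √(2 * (F.Pi τ * F.E τ)) * hM

theorem Λ_eq (F : T2Flow) (τ : ℝ) :
    F.Λ τ = (1/2) * exp (-2*τ) *
      ((∫ θ in (0:ℝ)..1, (exp (F.ρ τ θ) * F.Vτ τ θ) * (F.V τ θ - circleMean (F.V τ)))
        - ∫ θ in (0:ℝ)..1, exp (F.ρ τ θ) * F.Vτ τ θ) := by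
  have := F.continuous_ρ τ
  have := F.continuous_V τ
  have := F.continuous_Vτ τ
  unfold Λ
  rw [← intervalIntegral.integral_sub]
  · congr 1
    refine integral_congr fun θ _ => ?_
    ring
  all_goals exact Continuous.intervalIntegrable (by fun_prop) _ _

end T2Flow

/-- For `B₀` solutions, `|Λ| − (e^{−2τ}/2)|A| ≲ e^{−τ} (1 + e^{2(ΠE)^{1/2}}) Π E`. -/
theorem correction_bound_B0 :
    ∃ C : ℝ, 0 < C ∧ ∀ (F : T2Flow), F.IsEinsteinFlow → (∀ τ : ℝ, F.B τ = 0) →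
      ∀ τ : ℝ,
        |F.Λ τ| - (Real.exp (-2*τ) / 2) * |F.A τ|
          ≤ C * (Real.exp (-τ) * (1 + Real.exp (2 * Real.sqrt (F.Pi τ * F.E τ)))
              * (F.Pi τ * F.E τ)) := by
  refine ⟨1, one_pos, fun F _ hB τ => ?_⟩
  have h1 := F.abs_integral_Vτ_mul_V_sub_circleMean_le τ
  have h2 := F.abs_integral_exp_mul_Vτ_sub_A_le τ (hB τ)
  have hX : 0 ≤ F.Pi τ * F.E τ := mul_nonneg (F.Pi_nonneg τ) (F.E_nonneg τ)
  have h3 : exp √(2 * (F.Pi τ * F.E τ)) ≤ exp (2 * √(F.Pi τ * F.E τ)) := by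
    rw [exp_le_exp, sqrt_mul zero_le_two]
    gcongr
    rw [sqrt_le_left zero_le_two]
    norm_num
  have h4 : exp (-2 * τ) * exp τ = exp (-τ) := by
    rw [← exp_add]
    congr 1
    ring
  rw [F.Λ_eq, abs_mul, abs_of_pos (by positivity : 0 < 1 / 2 * exp (-2 * τ))]
  generalize (∫ θ in (0:ℝ)..1, exp (F.ρ τ θ) * F.Vτ τ θ) = a at h2 ⊢
  generalize (∫ θ in (0:ℝ)..1, (exp (F.ρ τ θ) * F.Vτ τ θ) * (F.V τ θ - circleMean (F.V τ))) = b
    at h1 ⊢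
  have h5 : |b - a| - |F.A τ| ≤ |b| + |a - F.A τ| := by
    have := abs_sub b a
    have := abs_sub_abs_le_abs_sub a (F.A τ)
    linarith
  have h6 : exp τ * exp √(2 * (F.Pi τ * F.E τ)) * (2 * (F.Pi τ * F.E τ))
      ≤ exp τ * exp (2 * √(F.Pi τ * F.E τ)) * (2 * (F.Pi τ * F.E τ)) := by gcongr
  calc 1 / 2 * exp (-2 * τ) * |b - a| - exp (-2 * τ) / 2 * |F.A τ|
      = 1 / 2 * exp (-2 * τ) * (|b - a| - |F.A τ|) := by ring
    _ ≤ 1 / 2 * exp (-2 * τ) * (exp τ * (2 * (F.Pi τ * F.E τ))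
          + exp τ * exp (2 * √(F.Pi τ * F.E τ)) * (2 * (F.Pi τ * F.E τ))) := by
        gcongr
        linarith
    _ = 1 * (exp (-τ) * (1 + exp (2 * √(F.Pi τ * F.E τ))) * (F.Pi τ * F.E τ)) := by
        rw [← h4]
        ring
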